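/- arXiv:2208.09077 — 2 statements merged into one kernel-verified Lean document; each statement's English description precedes it below -/
import Mathlib

section
/- For every natural number k ≥ 6 and every natural number ℓ, setting n = 2^k - 1, one has n^4 - 6n^3 + 31n^2 - 26n + 120 ≠ 15 · 2^ℓ. -/
theorem g5_two_pow_sub_one_ne (k ℓ : ℕ) (hk : 6 ≤ k) :
    ((2 : ℤ) ^ k - 1) ^ 4 - 6 * ((2 : ℤ) ^ k - 1) ^ 3 + 31 * ((2 : ℤ) ^ k - 1) ^ 2
      - 26 * ((2 : ℤ) ^ k - 1) + 120 ≠ 15 * 2 ^ ℓ := by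
  intro h
  obtain ⟨j, rfl⟩ := Nat.exists_eq_add_of_le hk
  rw [pow_add] at h
  generalize (2 : ℤ) ^ j = y at h
  have h2 : 128 * (131072 * y ^ 4 - 20480 * y ^ 3 + 1760 * y ^ 2 - 55 * y) + 184
      = 15 * (2 : ℤ) ^ ℓ := by
    rw [← h]; ring
  generalize 131072 * y ^ 4 - 20480 * y ^ 3 + 1760 * y ^ 2 - 55 * y = z at h2
  by_cases hl : 7 ≤ ℓ
  · obtain ⟨m, rfl⟩ := Nat.exists_eq_add_of_le hl
    rw [pow_add] at h2
    generalize (2 : ℤ) ^ m = w at h2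
    omega
  · have : ℓ < 7 := by omega
    interval_cases ℓ <;> omega
end

section
/- Let C be a binary linear code of length n over 𝔽₂ with {0} ⊊ C ⊊ 𝔽₂^n and with the all-ones vector 1_n ∈ C. Let d be the minimum distance of C and d^⊥ the minimum distance of C^⊥. Suppose there is a natural number t with 1 ≤ t < d such that the number of values u with 0 < u ≤ n - t for which C contains a codeword of weight u equals d^⊥ - t, and suppose d^⊥ - t = 4. Then (d^⊥, t) = (6, 2) or (d^⊥, t) = (8, 4). -/
/-- The (Hamming) weight of a vector in `𝔽₂ⁿ`. -/
def wt {n : ℕ} (x : Fin n → ZMod 2) : ℕ :=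
  (Finset.univ.filter fun i => x i ≠ 0).card

/-- The dual code of a binary code `C`, as a set of vectors. -/
def dualSet {n : ℕ} (C : Submodule (ZMod 2) (Fin n → ZMod 2)) : Set (Fin n → ZMod 2) :=
  {y | ∀ x ∈ C, ∑ i, x i * y i = 0}

/-- The minimum distance of a (nonzero) code: the least weight of a nonzero codeword
(`0` if there is none, by the convention `sInf ∅ = 0`). -/
noncomputable def minDist {n : ℕ} (D : Set (Fin n → ZMod 2)) : ℕ :=
  sInf {u | ∃ x ∈ D, x ≠ 0 ∧ wt x = u}

open Classical in
/-- codewords as a finset -/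
noncomputable def cw {n : ℕ} (C : Submodule (ZMod 2) (Fin n → ZMod 2)) :
    Finset (Fin n → ZMod 2) := Finset.univ.filter (fun c => c ∈ C)

/-- the sign character -/
def sgn (a : ZMod 2) : ℤ := if a = 0 then 1 else -1

/-- sum of signs -/
def zz {n : ℕ} (x : Fin n → ZMod 2) : ℤ := ∑ i, sgn (x i)

lemma sgn_zero : sgn 0 = 1 := by decide

lemma sgn_add (a b : ZMod 2) : sgn (a + b) = sgn a * sgn b := by
  revert a b; decide

lemma sgn_sum {ι : Type*} (s : Finset ι) (f : ι → ZMod 2) :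
    sgn (∑ i ∈ s, f i) = ∏ i ∈ s, sgn (f i) := by
  classical
  induction s using Finset.induction_on with
  | empty => simp [sgn_zero]
  | insert a s ha ih => rw [Finset.sum_insert ha, Finset.prod_insert ha, sgn_add, ih]

lemma wt_le {n : ℕ} (x : Fin n → ZMod 2) : wt x ≤ n := by
  unfold wt
  exact (Finset.card_filter_le _ _).trans (by simp)

lemma zz_eq {n : ℕ} (x : Fin n → ZMod 2) : zz x = n - 2 * (wt x : ℤ) := by
  have h : ∀ i, sgn (x i) = 1 - 2 * (if x i ≠ 0 then 1 else 0) := by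
    intro i; unfold sgn; by_cases h : x i = 0 <;> simp [h]
  unfold zz wt
  simp only [h, Finset.sum_sub_distrib, ← Finset.mul_sum, Finset.sum_boole]
  simp

lemma wt_eq_zero {n : ℕ} (x : Fin n → ZMod 2) : wt x = 0 ↔ x = 0 := by
  unfold wt
  rw [Finset.card_eq_zero, Finset.filter_eq_empty_iff]
  simp [funext_iff]

lemma wt_compl {n : ℕ} (x : Fin n → ZMod 2) :
    wt ((fun _ => (1 : ZMod 2)) + x) + wt x = n := by
  have h : zz ((fun _ => (1 : ZMod 2)) + x) = - zz x := by
    unfold zz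
    rw [← Finset.sum_neg_distrib]
    refine Finset.sum_congr rfl fun i _ => ?_
    rw [Pi.add_apply, sgn_add]
    have : sgn 1 = -1 := by decide
    rw [this]; ring
  rw [zz_eq, zz_eq] at h
  omega

lemma wt_eq_n {n : ℕ} (x : Fin n → ZMod 2) : wt x = n ↔ x = fun _ => (1 : ZMod 2) := by
  have h := wt_compl x
  have h0 := wt_eq_zero ((fun _ => (1 : ZMod 2)) + x)
  have h2 : ∀ a : ZMod 2, 1 + a = 0 ↔ a = 1 := by decide
  constructor
  · intro hx
    have := h0.1 (by omega)
    funext i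
    exact (h2 _).1 (congrFun this i)
  · intro hx
    have : wt ((fun _ => (1 : ZMod 2)) + x) = 0 := by
      apply h0.2
      funext i
      rw [hx]
      exact (h2 _).2 rfl
    omega

lemma char_sum {n : ℕ} (C : Submodule (ZMod 2) (Fin n → ZMod 2)) (y : Fin n → ZMod 2)
    (hy : y ∉ dualSet C) : ∑ c ∈ cw C, sgn (∑ i, c i * y i) = 0 := by
  classical
  simp only [dualSet, Set.mem_ofPred_eq, not_forall] at hy
  obtain ⟨c0, hc0, h0⟩ := hy
  have h1 : sgn (∑ i, c0 i * y i) = -1 := by unfold sgn; simp [h0]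
  have : ∑ c ∈ cw C, sgn (∑ i, c i * y i) = ∑ c ∈ cw C, - sgn (∑ i, c i * y i) := by
    refine Finset.sum_bij' (fun c _ => c + c0) (fun c _ => c - c0) ?_ ?_ ?_ ?_ ?_
    · intro c hc
      simp only [cw, Finset.mem_filter, Finset.mem_univ, true_and] at hc ⊢
      exact C.add_mem hc hc0
    · intro c hc
      simp only [cw, Finset.mem_filter, Finset.mem_univ, true_and] at hc ⊢
      exact C.sub_mem hc hc0
    · intro c _; simp
    · intro c _; simp
    · intro c _
      have : ∑ i, (c + c0) i * y i = ∑ i, c i * y i + ∑ i, c0 i * y i := by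
        rw [← Finset.sum_add_distrib]
        exact Finset.sum_congr rfl fun i _ => by rw [Pi.add_apply]; ring
      rw [this, sgn_add, h1]; ring
  rw [Finset.sum_neg_distrib] at this
  omega

/-- the vector attached to a tuple of positions -/
def tupVec {n k : ℕ} (s : Fin k → Fin n) : Fin n → ZMod 2 :=
  fun i => ∑ j, if s j = i then 1 else 0

lemma wt_tupVec {n k : ℕ} (s : Fin k → Fin n) : wt (tupVec s) ≤ k := by
  classical
  unfold wt
  have : (Finset.univ.filter fun i => tupVec s i ≠ 0) ⊆ Finset.univ.image s := by
    intro i hi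
    simp only [Finset.mem_filter, Finset.mem_univ, true_and] at hi
    by_contra hn
    apply hi
    unfold tupVec
    apply Finset.sum_eq_zero
    intro j _
    rw [if_neg]
    rintro rfl
    exact hn (Finset.mem_image_of_mem _ (Finset.mem_univ _))
  calc _ ≤ _ := Finset.card_le_card this
    _ ≤ _ := Finset.card_image_le
    _ = k := by simp

lemma prod_tup {n k : ℕ} (s : Fin k → Fin n) (c : Fin n → ZMod 2) :
    ∏ j, sgn (c (s j)) = sgn (∑ i, c i * tupVec s i) := by
  rw [← sgn_sum]
  congr 1
  unfold tupVec
  simp only [Finset.mul_sum]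
  rw [Finset.sum_comm]
  simp

lemma moment_gen {n k : ℕ} (C : Submodule (ZMod 2) (Fin n → ZMod 2))
    (h : ∀ y : Fin n → ZMod 2, y ≠ 0 → wt y ≤ k → y ∉ dualSet C) :
    ∑ c ∈ cw C, zz c ^ k = (cw C).card *
      ∑ s : Fin k → Fin n, if tupVec s = 0 then (1 : ℤ) else 0 := by
  classical
  unfold zz
  simp only [Fintype.sum_pow]
  rw [Finset.sum_comm, Finset.mul_sum]
  refine Finset.sum_congr rfl fun s _ => ?_
  simp only [prod_tup]
  by_cases hs : tupVec s = 0
  · simp [hs, sgn_zero]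
  · rw [char_sum C _ (h _ hs (wt_tupVec s))]
    simp [hs]

lemma cw_top {n : ℕ} : cw (⊤ : Submodule (ZMod 2) (Fin n → ZMod 2)) = Finset.univ := by
  ext; simp [cw]

lemma moment_cmp {n k : ℕ} (C : Submodule (ZMod 2) (Fin n → ZMod 2))
    (h : ∀ y : Fin n → ZMod 2, y ≠ 0 → wt y ≤ k → y ∉ dualSet C) :
    2 ^ n * ∑ c ∈ cw C, zz c ^ k = (cw C).card * ∑ c : Fin n → ZMod 2, zz c ^ k := by
  classical
  have h2 := moment_gen (k := k) (⊤ : Submodule (ZMod 2) (Fin n → ZMod 2)) (by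
    intro y hy _ hd
    apply hy
    funext i
    have := hd (Pi.single i 1) trivial
    simpa [Pi.single_apply] using this)
  rw [cw_top] at h2
  rw [h2, moment_gen C h]
  simp [ZMod.card]
  ring

lemma sum_succ {n : ℕ} (f : ℤ → ℤ) :
    ∑ c : Fin (n + 1) → ZMod 2, f (zz c) =
      ∑ c : Fin n → ZMod 2, (f (zz c + 1) + f (zz c - 1)) := by
  have e := (Fin.consEquiv (fun _ : Fin (n + 1) => ZMod 2)).sum_comp (fun c => f (zz c))
  rw [← e, Fintype.sum_prod_type]
  have hu : (Finset.univ : Finset (ZMod 2)) = {0, 1} := by decide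
  rw [hu, Finset.sum_pair (by decide), ← Finset.sum_add_distrib]
  refine Finset.sum_congr rfl fun c _ => ?_
  have h0 : sgn 0 = 1 := by decide
  have h1 : sgn 1 = -1 := by decide
  simp only [zz, Fin.consEquiv, Equiv.coe_fn_mk, Fin.sum_univ_succ, Fin.cons_zero, Fin.cons_succ,
    h0, h1]
  congr 2 <;> ring

lemma full_moments (n : ℕ) :
    (∑ c : Fin n → ZMod 2, zz c ^ 2 = 2 ^ n * (n : ℤ)) ∧
    (∑ c : Fin n → ZMod 2, zz c ^ 4 = 2 ^ n * (3 * (n : ℤ) ^ 2 - 2 * n)) ∧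
    (∑ c : Fin n → ZMod 2, zz c ^ 6 = 2 ^ n * (15 * (n : ℤ) ^ 3 - 30 * n ^ 2 + 16 * n)) ∧
    (∑ c : Fin n → ZMod 2, zz c ^ 8 =
      2 ^ n * (105 * (n : ℤ) ^ 4 - 420 * n ^ 3 + 588 * n ^ 2 - 272 * n)) := by
  induction n with
  | zero => simp [zz]
  | succ n ih =>
    obtain ⟨h2, h4, h6, h8⟩ := ih
    have hc : ∑ c : Fin n → ZMod 2, (1 : ℤ) = 2 ^ n := by simp [ZMod.card]
    refine ⟨?_, ?_, ?_, ?_⟩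
    · rw [sum_succ (fun z => z ^ 2)]
      have : ∀ c : Fin n → ZMod 2, (zz c + 1) ^ 2 + (zz c - 1) ^ 2 = 2 * zz c ^ 2 + 2 * 1 := by
        intro c; ring
      simp only [this, Finset.sum_add_distrib, ← Finset.mul_sum, h2, hc]
      push_cast; ring
    · rw [sum_succ (fun z => z ^ 4)]
      have : ∀ c : Fin n → ZMod 2, (zz c + 1) ^ 4 + (zz c - 1) ^ 4 =
          2 * zz c ^ 4 + 12 * zz c ^ 2 + 2 * 1 := by
        intro c; ring
      simp only [this, Finset.sum_add_distrib, ← Finset.mul_sum, h2, h4, hc]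
      push_cast; ring
    · rw [sum_succ (fun z => z ^ 6)]
      have : ∀ c : Fin n → ZMod 2, (zz c + 1) ^ 6 + (zz c - 1) ^ 6 =
          2 * zz c ^ 6 + 30 * zz c ^ 4 + 30 * zz c ^ 2 + 2 * 1 := by
        intro c; ring
      simp only [this, Finset.sum_add_distrib, ← Finset.mul_sum, h2, h4, h6, hc]
      push_cast; ring
    · rw [sum_succ (fun z => z ^ 8)]
      have : ∀ c : Fin n → ZMod 2, (zz c + 1) ^ 8 + (zz c - 1) ^ 8 =
          2 * zz c ^ 8 + 56 * zz c ^ 6 + 140 * zz c ^ 4 + 56 * zz c ^ 2 + 2 * 1 := by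
        intro c; ring
      simp only [this, Finset.sum_add_distrib, ← Finset.mul_sum, h2, h4, h6, h8, hc]
      push_cast; ring

lemma code_moment {n k : ℕ} (C : Submodule (ZMod 2) (Fin n → ZMod 2))
    (hk : k < minDist (dualSet C)) (p : ℤ)
    (hp : ∑ c : Fin n → ZMod 2, zz c ^ k = 2 ^ n * p) :
    ∑ c ∈ cw C, zz c ^ k = (cw C).card * p := by
  have h := moment_cmp (k := k) C (by
    intro y hy hw hd
    have : minDist (dualSet C) ≤ wt y := Nat.sInf_le ⟨y, hd, hy, rfl⟩
    omega)
  rw [hp] at h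
  have h2 : (2 : ℤ) ^ n ≠ 0 := by positivity
  apply mul_left_cancel₀ h2
  rw [h]; ring

lemma four_dvd_aux (k a : ℕ) (h : a ∣ 3 * 2 ^ k) (ha : 6 < a) : 4 ∣ a := by
  obtain ⟨x, y, hx, hy, rfl⟩ := (Nat.dvd_mul).1 h
  obtain ⟨j, hj, rfl⟩ := (Nat.dvd_prime_pow Nat.prime_two).1 hy
  have hx3 : x ≤ 3 := Nat.le_of_dvd (by norm_num) hx
  have : 2 ≤ j := by
    by_contra hlt
    have : j = 0 ∨ j = 1 := by omega
    rcases this with rfl | rfl <;> omega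
  exact Dvd.dvd.mul_left (pow_dvd_pow 2 this) x

lemma card_cw {n : ℕ} (C : Submodule (ZMod 2) (Fin n → ZMod 2)) :
    ∃ k, (cw C).card = 2 ^ k := by
  classical
  refine ⟨Module.finrank (ZMod 2) C, ?_⟩
  have h := Module.card_eq_pow_finrank (K := ZMod 2) (V := C)
  rw [ZMod.card] at h
  rw [← h, cw, Fintype.card_subtype]

set_option maxHeartbeats 1000000 in
/-- The arithmetic-analytic core. -/
lemma core {n : ℕ} (C : Submodule (ZMod 2) (Fin n → ZMod 2))
    (h1 : (fun _ => (1 : ZMod 2)) ∈ C) (hd : 10 ≤ minDist (dualSet C)) (a b : ℕ)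
    (ha : 6 < a) (hb : 6 < b) (ha2 : 2 * a < n) (hb2 : 2 * b < n)
    (hw : ∀ c ∈ C, wt c = 0 ∨ wt c = n ∨ wt c = a ∨ wt c = b ∨ wt c + a = n ∨ wt c + b = n) :
    False := by
  classical
  obtain ⟨f2, f4, f6, f8⟩ := full_moments n
  have m2 := code_moment C (by omega) _ f2
  have m4 := code_moment C (by omega) _ f4
  have m6 := code_moment C (by omega) _ f6
  have m8 := code_moment C (by omega) _ f8
  have m0 : ∑ c ∈ cw C, (1 : ℤ) = (cw C).card := by simp
  obtain ⟨k, hk⟩ := card_cw C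
  have hNpos : ((cw C).card : ℤ) ≠ 0 := by rw [hk]; positivity
  set N : ℤ := ((cw C).card : ℤ) with hN
  obtain ⟨A, hA⟩ : ∃ A : ℤ, A = ((n : ℤ) - 2 * a) ^ 2 := ⟨_, rfl⟩
  obtain ⟨B, hB⟩ : ∃ B : ℤ, B = ((n : ℤ) - 2 * b) ^ 2 := ⟨_, rfl⟩
  have hz : ∀ c ∈ cw C, c = 0 ∨ c = (fun _ => (1 : ZMod 2)) ∨
      zz c ^ 2 = A ∨ zz c ^ 2 = B := by
    intro c hc
    have hc' : c ∈ C := by simpa [cw] using hc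
    rw [zz_eq]
    rcases hw c hc' with h | h | h | h | h | h
    · left; exact (wt_eq_zero c).1 h
    · right; left; exact (wt_eq_n c).1 h
    · right; right; left; rw [hA, h]
    · right; right; right; rw [hB, h]
    · right; right; left; rw [hA, show ((wt c : ℕ) : ℤ) = n - a by omega]; ring
    · right; right; right; rw [hB, show ((wt c : ℕ) : ℤ) = n - b by omega]; ring
  have hz0 : zz (0 : Fin n → ZMod 2) ^ 2 = (n : ℤ) ^ 2 := by
    rw [zz_eq, (wt_eq_zero _).2 rfl]; push_cast; ring
  have hz1 : zz (fun _ : Fin n => (1 : ZMod 2)) ^ 2 = (n : ℤ) ^ 2 := by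
    rw [zz_eq, (wt_eq_n _).2 rfl]; push_cast; ring
  have e1 : ∑ c ∈ cw C, (zz c ^ 2 - A) * (zz c ^ 2 - B) * ((n : ℤ) ^ 2 - zz c ^ 2) = 0 := by
    apply Finset.sum_eq_zero
    intro c hc
    rcases hz c hc with h | h | h | h
    · rw [h, hz0]; ring
    · rw [h, hz1]; ring
    · rw [h]; ring
    · rw [h]; ring
  have e2 : ∑ c ∈ cw C,
      (zz c ^ 2 - A) * (zz c ^ 2 - B) * ((n : ℤ) ^ 2 - zz c ^ 2) * zz c ^ 2 = 0 := by
    apply Finset.sum_eq_zero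
    intro c hc
    rcases hz c hc with h | h | h | h
    · rw [h, hz0]; ring
    · rw [h, hz1]; ring
    · rw [h]; ring
    · rw [h]; ring
  have e3 : ∑ c ∈ cw C, (zz c ^ 2 - A) * (zz c ^ 2 - B) =
      2 * (((n : ℤ) ^ 2 - A) * ((n : ℤ) ^ 2 - B)) := by
    have hne : (0 : Fin n → ZMod 2) ≠ (fun _ => (1 : ZMod 2)) := by
      intro h
      have := congrFun h ⟨0, by omega⟩
      simp at this
    have hsub : ({0, (fun _ => (1 : ZMod 2))} : Finset (Fin n → ZMod 2)) ⊆ cw C := by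
      intro c hc
      simp only [Finset.mem_insert, Finset.mem_singleton] at hc
      rcases hc with rfl | rfl
      · simp [cw]
      · simpa [cw] using h1
    rw [← Finset.sum_subset hsub, Finset.sum_pair hne, hz0, hz1]
    · ring
    · intro c hc hn
      simp only [Finset.mem_insert, Finset.mem_singleton, not_or] at hn
      rcases hz c hc with h | h | h | h
      · exact absurd h hn.1
      · exact absurd h hn.2
      · rw [h]; ring
      · rw [h]; ring
  have x1 : ∀ z : ℤ, (z ^ 2 - A) * (z ^ 2 - B) * ((n : ℤ) ^ 2 - z ^ 2) =
      (-1) * z ^ 6 + (n ^ 2 + A + B) * z ^ 4 + (-(A * B) - n ^ 2 * (A + B)) * z ^ 2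
        + (n ^ 2 * A * B) * 1 := by
    intro z; ring
  have x2 : ∀ z : ℤ, (z ^ 2 - A) * (z ^ 2 - B) * ((n : ℤ) ^ 2 - z ^ 2) * z ^ 2 =
      (-1) * z ^ 8 + (n ^ 2 + A + B) * z ^ 6 + (-(A * B) - n ^ 2 * (A + B)) * z ^ 4
        + (n ^ 2 * A * B) * z ^ 2 := by
    intro z; ring
  have x3 : ∀ z : ℤ, (z ^ 2 - A) * (z ^ 2 - B) =
      z ^ 4 + (- A - B) * z ^ 2 + (A * B) * 1 := by
    intro z; ring
  simp only [x1, Finset.sum_add_distrib, ← Finset.mul_sum, m2, m4, m6, m0] at e1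
  simp only [x2, Finset.sum_add_distrib, ← Finset.mul_sum, m2, m4, m6, m8] at e2
  simp only [x3, Finset.sum_add_distrib, ← Finset.mul_sum, m2, m4, m0] at e3
  obtain ⟨m, hm⟩ : ∃ m : ℤ, (n : ℤ) = m + 2 := ⟨n - 2, by ring⟩
  have hm12 : 12 ≤ m := by omega
  have hn0 : (n : ℤ) * (n - 1) ≠ 0 := by
    exact mul_ne_zero (by omega) (by omega)
  have g1 : 3 * m ^ 2 - 2 * m - (A + B) * m + A * B = 0 := by
    apply mul_left_cancel₀ (mul_ne_zero hNpos hn0)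
    rw [mul_zero, ← e1, hm]; ring
  have g2 : 15 * m ^ 3 - 30 * m ^ 2 + 16 * m - (A + B) * (3 * m ^ 2 - 2 * m)
      + A * B * m = 0 := by
    apply mul_left_cancel₀ (mul_ne_zero hNpos hn0)
    rw [mul_zero, ← e2, hm]; ring
  have gS : A + B = 6 * m - 8 := by
    have hmm : 2 * m * (m - 1) ≠ 0 := mul_ne_zero (by omega) (by omega)
    apply mul_left_cancel₀ hmm
    linear_combination m * g1 - g2
  have gP : A * B = 3 * m ^ 2 - 6 * m := by
    linear_combination g1 + m * gS
  have key : 4 * ((a : ℤ) * (n - a) * (b * (n - b))) = 3 * N := by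
    have hA' : (n : ℤ) ^ 2 - A = 4 * (a * (n - a)) := by rw [hA]; ring
    have hB' : (n : ℤ) ^ 2 - B = 4 * (b * (n - b)) := by rw [hB]; ring
    have e4 : 2 * ((n : ℤ) ^ 4 + (-A - B) * n ^ 2 + A * B * 1) =
        2 * ((4 * (a * (n - a))) * (4 * (b * (n - b)))) := by
      rw [← hA', ← hB']; ring
    rw [e4] at e3
    have hS' : A + B = 6 * n - 20 := by rw [gS, hm]; ring
    have hP' : A * B = 3 * (n : ℤ) ^ 2 - 18 * n + 24 := by rw [gP, hm]; ring
    have : N * 24 = 32 * ((a : ℤ) * (n - a) * (b * (n - b))) := by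
      linear_combination e3 + N * n * hS' - N * hP'
    linarith
  obtain ⟨a', ha'⟩ : ∃ a', n = a + a' := ⟨n - a, by omega⟩
  obtain ⟨b', hb'⟩ : ∃ b', n = b + b' := ⟨n - b, by omega⟩
  have keyN : 4 * (a * a' * (b * b')) = 3 * 2 ^ k := by
    have q1 : (n : ℤ) - a = a' := by rw [ha']; push_cast; ring
    have q2 : (n : ℤ) - b = b' := by rw [hb']; push_cast; ring
    rw [q1, q2, hN, hk] at key
    exact_mod_cast key
  have d1 : 4 ∣ a := four_dvd_aux k a ⟨4 * (a' * (b * b')), by rw [← keyN]; ring⟩ ha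
  have d2 : 4 ∣ a' := four_dvd_aux k a' ⟨4 * (a * (b * b')), by rw [← keyN]; ring⟩ (by omega)
  have d3 : 4 ∣ b := four_dvd_aux k b ⟨4 * (a * a' * b'), by rw [← keyN]; ring⟩ hb
  obtain ⟨u, hu⟩ := d1
  obtain ⟨v, hv⟩ := d2
  obtain ⟨w, hw'⟩ := d3
  have hn4 : (n : ℤ) = 4 * (u + v) := by rw [ha', hu, hv]; push_cast; ring
  have ha4 : (a : ℤ) = 4 * u := by rw [hu]; push_cast; ring
  have hb4 : (b : ℤ) = 4 * w := by rw [hw']; push_cast; ring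
  have hm' : m = n - 2 := by rw [hm]; ring
  rw [hA, hB, hm', ha4, hb4, hn4] at gS
  have : (8 : ℤ) * (2 * ((u + v - 2 * u) ^ 2 + (u + v - 2 * w) ^ 2) - 3 * (u + v)) = -20 := by
    linear_combination gS
  omega

lemma wt_even {n : ℕ} (y : Fin n → ZMod 2) (h : ∑ i, y i = 0) : Even (wt y) := by
  have h2 : ∑ i, y i = ((wt y : ℕ) : ZMod 2) := by
    unfold wt
    rw [Finset.card_filter]
    push_cast
    refine Finset.sum_congr rfl fun i _ => ?_
    generalize y i = a
    revert a; decide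
  rw [h] at h2
  exact (ZMod.natCast_eq_zero_iff_even).1 h2.symm

theorem am_condition_four (n : ℕ) (C : Submodule (ZMod 2) (Fin n → ZMod 2))
    (hC0 : C ≠ ⊥) (hCtop : C ≠ ⊤)
    (h1 : (fun _ => (1 : ZMod 2)) ∈ C)
    (t : ℕ) (ht1 : 1 ≤ t) (ht2 : t < minDist (C : Set (Fin n → ZMod 2)))
    (hAM : {u | 0 < u ∧ u ≤ n - t ∧ ∃ c ∈ C, wt c = u}.ncard = minDist (dualSet C) - t)
    (hfour : minDist (dualSet C) - t = 4) :
    (minDist (dualSet C) = 6 ∧ t = 2) ∨ (minDist (dualSet C) = 8 ∧ t = 4) := by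
  classical
  have hev : Even (minDist (dualSet C)) := by
    have hne : {u | ∃ x ∈ dualSet C, x ≠ 0 ∧ wt x = u}.Nonempty := by
      by_contra hne
      rw [Set.not_nonempty_iff_eq_empty] at hne
      have : minDist (dualSet C) = 0 := by unfold minDist; rw [hne]; simp
      omega
    obtain ⟨y, hy, _, hyw⟩ := Nat.sInf_mem hne
    have : minDist (dualSet C) = wt y := hyw.symm
    rw [this]
    apply wt_even
    have := hy _ h1
    simpa using this
  obtain ⟨e, he⟩ := hev
  by_contra hcon
  have hd10 : 10 ≤ minDist (dualSet C) := by omega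
  have ht6 : 6 ≤ t := by omega
  rw [hfour] at hAM
  have hmin : ∀ c ∈ C, wt c ≠ 0 → t < wt c := by
    intro c hc h0
    have : minDist (C : Set (Fin n → ZMod 2)) ≤ wt c :=
      Nat.sInf_le ⟨c, hc, fun h => h0 ((wt_eq_zero c).2 h), rfl⟩
    omega
  have hcompl : ∀ c ∈ C, ∃ c' ∈ C, wt c' + wt c = n := fun c hc =>
    ⟨_, C.add_mem h1 hc, wt_compl c⟩
  -- the weight set
  set W : Finset ℕ := ((cw C).image wt).filter (fun u => 0 < u ∧ u < n) with hW
  have hWmem : ∀ u, u ∈ W ↔ 0 < u ∧ u < n ∧ ∃ c ∈ C, wt c = u := by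
    intro u
    simp only [hW, cw, Finset.mem_filter, Finset.mem_image, Finset.mem_univ, true_and]
    tauto
  have hWset : {u | 0 < u ∧ u ≤ n - t ∧ ∃ c ∈ C, wt c = u} = (W : Set ℕ) := by
    ext u
    simp only [Set.mem_ofPred_eq, Finset.mem_coe, hWmem]
    constructor
    · rintro ⟨h0, hu, c, hc, rfl⟩
      have := hmin c hc (by omega)
      exact ⟨h0, by omega, c, hc, rfl⟩
    · rintro ⟨h0, hu, c, hc, rfl⟩
      obtain ⟨c', hc', hs⟩ := hcompl c hc
      have := hmin c' hc' (by omega)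
      exact ⟨h0, by omega, c, hc, rfl⟩
  rw [hWset, Set.ncard_coe_finset] at hAM
  have hWsymm : ∀ u ∈ W, n - u ∈ W := by
    intro u hu
    rw [hWmem] at hu ⊢
    obtain ⟨h0, h2, c, hc, rfl⟩ := hu
    obtain ⟨c', hc', hs⟩ := hcompl c hc
    exact ⟨by omega, by omega, c', hc', by omega⟩
  have hWlt : ∀ u ∈ W, u < n := fun u hu => ((hWmem u).1 hu).2.1
  have hLG : (W.filter (fun u => 2 * u < n)).card = (W.filter (fun u => n < 2 * u)).card := by
    refine Finset.card_bij' (fun u _ => n - u) (fun u _ => n - u) ?_ ?_ ?_ ?_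
    · intro u hu
      rw [Finset.mem_filter] at hu ⊢
      have := hWlt u hu.1
      exact ⟨hWsymm u hu.1, by omega⟩
    · intro u hu
      rw [Finset.mem_filter] at hu ⊢
      have := hWlt u hu.1
      exact ⟨hWsymm u hu.1, by omega⟩
    · intro u hu
      have := hWlt u (Finset.mem_filter.1 hu).1
      show n - (n - u) = u
      omega
    · intro u hu
      have := hWlt u (Finset.mem_filter.1 hu).1
      show n - (n - u) = u
      omega
  have hM : (W.filter (fun u => 2 * u = n)).card ≤ 1 := by
    rw [Finset.card_le_one]
    intro x hx y hy
    have := (Finset.mem_filter.1 hx).2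
    have := (Finset.mem_filter.1 hy).2
    omega
  have hsplit : W.card = (W.filter (fun u => 2 * u < n)).card +
      ((W.filter (fun u => n < 2 * u)).card + (W.filter (fun u => 2 * u = n)).card) := by
    rw [← Finset.card_union_of_disjoint, ← Finset.card_union_of_disjoint]
    · congr 1
      ext u
      simp only [Finset.mem_union, Finset.mem_filter]
      have : 2 * u < n ∨ n < 2 * u ∨ 2 * u = n := by omega
      tauto
    · rw [Finset.disjoint_left]
      intro u hu
      simp only [Finset.mem_union, Finset.mem_filter] at hu ⊢
      omega
    · rw [Finset.disjoint_left]
      intro u hu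
      simp only [Finset.mem_filter] at hu ⊢
      omega
  have hL2 : (W.filter (fun u => 2 * u < n)).card = 2 := by omega
  have hM0 : (W.filter (fun u => 2 * u = n)).card = 0 := by omega
  obtain ⟨a, b, hab, hLab⟩ := Finset.card_eq_two.1 hL2
  have hmemL : ∀ u, (u ∈ W ∧ 2 * u < n) ↔ (u = a ∨ u = b) := by
    intro u
    have hf : u ∈ W.filter (fun u => 2 * u < n) ↔ u ∈ ({a, b} : Finset ℕ) := by rw [hLab]
    simpa only [Finset.mem_filter, Finset.mem_insert, Finset.mem_singleton] using hf
  have haL := (hmemL a).2 (Or.inl rfl)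
  have hbL := (hmemL b).2 (Or.inr rfl)
  have hbig : ∀ u ∈ W, 6 < u := by
    intro u hu
    obtain ⟨h0, _, c, hc, rfl⟩ := (hWmem u).1 hu
    have := hmin c hc (by omega)
    omega
  refine core C h1 hd10 a b (hbig a haL.1) (hbig b hbL.1) haL.2 hbL.2 ?_
  intro c hc
  by_cases h0 : wt c = 0
  · exact Or.inl h0
  by_cases hn : wt c = n
  · exact Or.inr (Or.inl hn)
  have hle := wt_le c
  have hcW : wt c ∈ W := (hWmem _).2 ⟨by omega, by omega, c, hc, rfl⟩
  rcases lt_trichotomy (2 * wt c) n with h | h | h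
  · have := (hmemL _).1 ⟨hcW, h⟩
    omega
  · exfalso
    rw [Finset.card_eq_zero, Finset.filter_eq_empty_iff] at hM0
    exact hM0 hcW h
  · have := (hmemL _).1 ⟨hWsymm _ hcW, by omega⟩
    omega
end
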